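/- For every integer n ≥ 2 and every λ with 1/(n+1) ≤ λ ≤ 1/n, the probability distribution p(n,λ) = (p_0(n,λ),…,p_{n+1}(n,λ)) is majorised by q(n,λ) = (q_0(n,λ),…,q_{n+1}(n,λ)), i.e. for every k ∈ {0,…,n+1} the sum of the k+1 smallest entries of p(n,λ) is at least the sum of the k+1 smallest entries of q(n,λ). -/

import Mathlib

/-- The output distribution p(n,λ) of the general attenuator with Fock environment |n⟩,
for ℓ = 0, …, n+1 (the case ℓ = n+1 is the continuous extension of the formula
… · λ^(n-ℓ) · …, which involves λ⁻¹, valid for all λ ∈ (0,1)). -/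
noncomputable def pdist (n ℓ : ℕ) (t : ℝ) : ℝ :=
  if ℓ ≤ n then
    1 / (2 * ((n : ℝ) + 1) * (1 - t)) * ((n + 1).choose ℓ : ℝ) * (1 - t) ^ ℓ * t ^ (n - ℓ) *
      ((1 - t) * ((n : ℝ) - (ℓ : ℝ) + 1) + (((n : ℝ) + 1) * (1 - t) - (ℓ : ℝ)) ^ 2)
  else ((n : ℝ) + 1) * t * (1 - t) ^ n / 2

/-- The output distribution q(n,λ) (spectrum of the joint output state). -/
noncomputable def qdist (n ℓ : ℕ) (t : ℝ) : ℝ :=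
  if ℓ ≤ n then
    1 / (2 * ((n : ℝ) + 1) * (1 - t)) * ((n + 1).choose ℓ : ℝ) * (1 - t) ^ ℓ * t ^ (n - ℓ) *
      (t * (ℓ : ℝ) + (((n : ℝ) + 1) * (1 - t) - (ℓ : ℝ)) ^ 2)
  else (1 - t) ^ n * (1 + ((n : ℝ) + 1) * t) / 2


lemma ineq_p0q2 (t e : ℝ) (he : 0 ≤ e) (het : e ≤ t) (ht : t ≤ 1/2) :
    (1+e-t)*((1+e)-2*t+(2-(1+e))^2) ≤ 2*(1+e)*(1-t)^2 := by
  have : 0 ≤ e*((1-t)*(1-2*t)+e*(t-e)) := by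
    apply mul_nonneg he
    have := mul_nonneg (show 0 ≤ 1-t by linarith) (show 0 ≤ 1-2*t by linarith)
    have := mul_nonneg he (sub_nonneg.2 het)
    linarith
  nlinarith
lemma ineq_q0p2 (t e : ℝ) (he : 0 ≤ e) (het : e ≤ t) (ht : t ≤ 1/2) (h : 3*t=1+e ∨ t ≤ 1/3) :
    (1+e-t)*(2*(1-t)+(2-(1+e))^2) ≤ 2*(2+e)*(1-t)^2 := by
  rcases h with h | h
  · obtain rfl : e = 3*t-1 := by linarith
    have h3 : 0 ≤ 1-2*t := by linarith
    have h4 : 0 ≤ 3*t-1 := by linarith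
    nlinarith [mul_nonneg h3 h4, mul_nonneg (mul_nonneg h3 h4) h4, mul_nonneg (mul_nonneg h3 h4) h3, mul_nonneg h3 (sq_nonneg (3*t-1)), mul_nonneg h3 (sq_nonneg t)]
  · nlinarith [mul_nonneg he (sub_nonneg.2 het), mul_nonneg (sub_nonneg.2 het) (sub_nonneg.2 h), mul_nonneg he (sub_nonneg.2 h), mul_nonneg (mul_nonneg he (sub_nonneg.2 het)) (sub_nonneg.2 h), mul_nonneg (mul_nonneg he (sub_nonneg.2 het)) he,mul_nonneg (mul_nonneg he (sub_nonneg.2 het)) (sub_nonneg.2 het), mul_nonneg (mul_nonneg he (sub_nonneg.2 h)) (sub_nonneg.2 h)]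
lemma ineq_d3 (t e : ℝ) (he : 0 ≤ e) (het : e ≤ t) (ht : t ≤ 1/2) (h : 3*t=1+e ∨ t ≤ 1/3) :
    6*(1-t)^2*e ≤ (1+e-t)*(1+e-2*t)*(3-(1+e)) := by
  rcases h with h | h
  · obtain rfl : e = 3*t-1 := by linarith
    nlinarith [mul_nonneg (show 0 ≤ 1-t by linarith) (sq_nonneg (2*t-1))]
  · nlinarith [mul_nonneg he (sub_nonneg.2 het), mul_nonneg (sub_nonneg.2 het) (sub_nonneg.2 h), mul_nonneg he (sub_nonneg.2 h), mul_nonneg (mul_nonneg he (sub_nonneg.2 het)) (sub_nonneg.2 h), mul_nonneg (mul_nonneg he (sub_nonneg.2 het)) he,mul_nonneg (mul_nonneg he (sub_nonneg.2 het)) (sub_nonneg.2 het), mul_nonneg (mul_nonneg he (sub_nonneg.2 h)) (sub_nonneg.2 h)]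
lemma ineq_p1q3 (t e : ℝ) (he : 0 ≤ e) (het : e ≤ t) (ht : t ≤ 1/2)
    (h : 3*t=1+e ∨ 4*t=1+e ∨ t ≤ 1/4) :
    (1+e-t)*(1+e-2*t)*(1+e-3*t+(3-(1+e))^2) ≤ 6*(1-t)^2*(1-t+(1-(1+e))^2) := by
  rcases h with h | h | h
  · obtain rfl : e = 3*t-1 := by linarith
    have := mul_nonneg (mul_nonneg (show 0 ≤ 1-2*t by linarith) (show 0 ≤ 2-3*t by linarith)) (sq_nonneg (1-t))
    nlinarith
  · obtain rfl : e = 4*t-1 := by linarith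
    have h3 : 0 ≤ 1-3*t := by linarith
    have h4 : 0 ≤ 4*t-1 := by linarith
    nlinarith [mul_nonneg h3 h4, mul_nonneg (mul_nonneg h3 h4) h4, mul_nonneg (mul_nonneg h3 h4) h3, mul_nonneg h3 (sq_nonneg (4*t-1)), mul_nonneg h3 (sq_nonneg t)]
  · have h0 : 0 ≤ t := by linarith
    have h1 := sub_nonneg.2 het
    have h2 := sub_nonneg.2 h
    nlinarith [mul_nonneg he h1, mul_nonneg h1 h2, mul_nonneg he h2, mul_nonneg (mul_nonneg he h1) h2, mul_nonneg (mul_nonneg he h1) he,mul_nonneg (mul_nonneg he h1) h1, mul_nonneg (mul_nonneg he h2) h2, mul_nonneg (mul_nonneg h1 h2) h2, mul_nonneg (mul_nonneg h1 h1) h2, mul_nonneg (mul_nonneg h1 h1) h1]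
lemma ineq_q_mono2 (t e : ℝ) (he : 0 ≤ e) (het : e ≤ t) (ht : t ≤ 1/2) (h : 3*t=1+e ∨ 4*t ≤ 1+e) :
    (1+e-2*t)*(1+e-3*t+(3-(1+e))^2) ≤ 3*(1-t)*(1+e-2*t+(2-(1+e))^2) := by
  rcases h with h | h
  · obtain rfl : e = 3*t-1 := by linarith
    have := mul_nonneg (mul_nonneg (show 0 ≤ 1-2*t by linarith) (show 0 ≤ 2-3*t by linarith)) (show 0 ≤ 1-t by linarith)
    nlinarith
  · have h1 : (1+e-2*t) * (1+e-3*t+(3-(1+e))^2) ≤ (1-t)*(1+e-3*t+(3-(1+e))^2) := by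
      apply mul_le_mul_of_nonneg_right (by linarith)
      nlinarith
    refine h1.trans ?_
    rw [mul_comm 3 (1-t), mul_assoc]
    apply mul_le_mul_of_nonneg_left _ (by linarith)
    nlinarith [sq_nonneg (e-1/4)]
lemma ineq_q_mono (t e d : ℝ) (he : 0 ≤ e) (het : e ≤ t) (ht : t ≤ 1/2) (hd : 3 ≤ d) (h : 0 ≤ 1+e-d*t) :
    (1+e-d*t)*(1+e-(d+1)*t+((d+1)-(1+e))^2) ≤ (d+1)*(1-t)*(1+e-d*t+(d-(1+e))^2) := by
  have key : 1+e-(d+1)*t+((d+1)-(1+e))^2 ≤ (d+1)*(1+e-d*t+(d-(1+e))^2) := by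
    have : 0 ≤ d * (1+e-d*t) := by positivity
    have h2 : 0 ≤ (d-3)*(d-(1+e))^2 := mul_nonneg (by linarith) (sq_nonneg _)
    nlinarith
  have h0 : 0 ≤ (d+1)*(1+e-d*t+(d-(1+e))^2) := by positivity
  calc _ ≤ (1+e-d*t)*((d+1)*(1+e-d*t+(d-(1+e))^2)) := mul_le_mul_of_nonneg_left key h
    _ ≤ (1-t)*((d+1)*(1+e-d*t+(d-(1+e))^2)) := mul_le_mul_of_nonneg_right (by nlinarith) h0
    _ = _ := by ring
lemma ineq_p_mono (t e d : ℝ) (he : 0 ≤ e) (het : e ≤ t) (ht : t ≤ 1/2) (hd : 2 ≤ d) (h : 0 ≤ 1+e-d*t) :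
    (1+e-d*t)*((1-t)*(d+1)+((d+1)-(1+e))^2) ≤ (d+1)*(1-t)*((1-t)*d+(d-(1+e))^2) := by
  have hx : 1/2 ≤ 1-t := by linarith
  have key : (1-t)*(d+1)+((d+1)-(1+e))^2 ≤ (d+1)*((1-t)*d+(d-(1+e))^2) := by
    have h2 : 0 ≤ (d-2)*(d-(1+e))^2 := mul_nonneg (by linarith) (sq_nonneg _)
    have h3 : 0 ≤ (d^2-1)*(1-t-1/2) := mul_nonneg (by nlinarith) (by linarith)
    nlinarith [sq_nonneg (d-(1+e)-1/2)]
  have h0 : 0 ≤ (d+1)*((1-t)*d+(d-(1+e))^2) := by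
    have : 0 ≤ (1-t)*d := mul_nonneg (by linarith) (by linarith)
    positivity
  calc _ ≤ (1+e-d*t)*((d+1)*((1-t)*d+(d-(1+e))^2)) := mul_le_mul_of_nonneg_left key h
    _ ≤ (1-t)*((d+1)*((1-t)*d+(d-(1+e))^2)) := mul_le_mul_of_nonneg_right (by nlinarith) h0
    _ = _ := by ring

lemma comb (S : Finset ℕ) (p q : ℕ → ℝ) (a b c2 c : ℕ) (ha : a ∈ S) (hb : b ∈ S) (hc : c ∈ S)
    (hab : a ≠ b) (hca : c ≠ a) (hcb : c ≠ b) (hcc : c ≠ c2)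
    (tot : ∑ l ∈ S, q l = ∑ l ∈ S, p l)
    (H1 : ∀ l ∈ S, l ≠ a → l ≠ b → q l ≤ p l)
    (H2 : ∀ l ∈ S, l ≠ a → l ≠ b → q l ≤ p a)
    (H3 : ∀ l ∈ S, l ≠ a → l ≠ b → l ≠ c2 → q l ≤ p b)
    (H4 : q b + q c ≤ p b + p c)
    (H5 : ∀ l ∈ S, l ≠ a → p l ≤ q a)
    (A : Finset ℕ) (hA : A ⊆ S) :
    ∃ B : Finset ℕ, B ⊆ S ∧ B.card = A.card ∧ ∑ l ∈ B, q l ≤ ∑ l ∈ A, p l := by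
  classical
  have one : ∀ d ∈ S, d ≠ a → A = S.erase d →
      ∃ B : Finset ℕ, B ⊆ S ∧ B.card = A.card ∧ ∑ l ∈ B, q l ≤ ∑ l ∈ A, p l := by
    rintro d hd hda rfl
    refine ⟨S.erase a, S.erase_subset a, by rw [Finset.card_erase_of_mem ha, Finset.card_erase_of_mem hd], ?_⟩
    have e1 := Finset.add_sum_erase S q ha
    have e2 := Finset.add_sum_erase S p hd
    have := H5 d hd hda
    linarith
  have rest : ∀ C ⊆ S, a ∉ C → b ∉ C → ∑ l ∈ C, q l ≤ ∑ l ∈ C, p l := by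
    intro C hC h1 h2
    refine Finset.sum_le_sum fun l hl => H1 l (hC hl) ?_ ?_
    · rintro rfl; exact h1 hl
    · rintro rfl; exact h2 hl
  by_cases haA : a ∈ A
  · by_cases hbA : b ∈ A
    · by_cases hS : A = S
      · subst hS; exact ⟨A, hA, rfl, tot.le⟩
      obtain ⟨d, hd, hdA⟩ : ∃ d ∈ S, d ∉ A := by
        by_contra hcon; push Not at hcon
        exact hS (hA.antisymm hcon)
      by_cases hex : ∃ d' ∈ S, d' ∉ A ∧ d' ≠ d
      · obtain ⟨d', hd', hdA', hne⟩ := hex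
        have hda : d ≠ a := by rintro rfl; exact hdA haA
        have hdb : d ≠ b := by rintro rfl; exact hdA hbA
        have hda' : d' ≠ a := by rintro rfl; exact hdA' haA
        have hdb' : d' ≠ b := by rintro rfl; exact hdA' hbA
        have hbe : b ∈ A.erase a := Finset.mem_erase.2 ⟨hab.symm, hbA⟩
        have n1 : d' ∉ (A.erase a).erase b := by simp [hdA']
        have n2 : d ∉ insert d' ((A.erase a).erase b) := by simp [hdA, hne.symm]
        have hsub : (A.erase a).erase b ⊆ S :=
          ((Finset.erase_subset _ _).trans (Finset.erase_subset _ _)).trans hA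
        refine ⟨insert d (insert d' ((A.erase a).erase b)), ?_, ?_, ?_⟩
        · exact Finset.insert_subset hd (Finset.insert_subset hd' hsub)
        · rw [Finset.card_insert_of_notMem n2, Finset.card_insert_of_notMem n1,
            Finset.card_erase_add_one hbe, Finset.card_erase_add_one haA]
        · rw [Finset.sum_insert n2, Finset.sum_insert n1]
          have e1 := Finset.add_sum_erase A p haA
          have e2 := Finset.add_sum_erase (A.erase a) p hbe
          have e3 := rest _ hsub (by simp) (by simp)
          have : q d + q d' ≤ p a + p b := by
            by_cases hd2 : d = c2
            · have := H2 d hd hda hdb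
              have := H3 d' hd' hda' hdb' (by rw [← hd2]; exact hne)
              linarith
            · have := H2 d' hd' hda' hdb'
              have := H3 d hd hda hdb hd2
              linarith
          linarith
      · push Not at hex
        apply one d hd (by rintro rfl; exact hdA haA)
        ext l
        simp only [Finset.mem_erase]
        constructor
        · intro hl; exact ⟨by rintro rfl; exact hdA hl, hA hl⟩
        · rintro ⟨h1, h2⟩; by_contra h3; exact h1 (hex l h2 h3)
    · by_cases hex : ∃ d ∈ S, d ∉ A ∧ d ≠ b
      · obtain ⟨d, hd, hdA, hdb⟩ := hex
        have hda : d ≠ a := by rintro rfl; exact hdA haA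
        have n1 : d ∉ A.erase a := by simp [hdA]
        refine ⟨insert d (A.erase a), Finset.insert_subset hd ((Finset.erase_subset _ _).trans hA), ?_, ?_⟩
        · rw [Finset.card_insert_of_notMem n1, Finset.card_erase_add_one haA]
        · rw [Finset.sum_insert n1]
          have e1 := Finset.add_sum_erase A p haA
          have e3 := rest _ ((Finset.erase_subset a _).trans hA) (by simp) (by simp [hbA])
          have := H2 d hd hda hdb
          linarith
      · push Not at hex
        apply one b hb hab.symm
        ext l
        simp only [Finset.mem_erase]
        constructor
        · intro hl; exact ⟨by rintro rfl; exact hbA hl, hA hl⟩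
        · rintro ⟨h1, h2⟩; by_contra h3; exact h1 (hex l h2 h3)
  · by_cases hbA : b ∈ A
    · by_cases hex : ∃ d ∈ S, d ∉ A ∧ d ≠ a ∧ d ≠ c2
      · obtain ⟨d, hd, hdA, hda, hd2⟩ := hex
        have hdb : d ≠ b := by rintro rfl; exact hdA hbA
        have n1 : d ∉ A.erase b := by simp [hdA]
        refine ⟨insert d (A.erase b), Finset.insert_subset hd ((Finset.erase_subset _ _).trans hA), ?_, ?_⟩
        · rw [Finset.card_insert_of_notMem n1, Finset.card_erase_add_one hbA]
        · rw [Finset.sum_insert n1]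
          have e1 := Finset.add_sum_erase A p hbA
          have e3 := rest _ ((Finset.erase_subset b _).trans hA) (by simp [haA]) (by simp)
          have := H3 d hd hda hdb hd2
          linarith
      · push Not at hex
        have hcA : c ∈ A := by
          by_contra h; exact hcc (hex c hc h hca)
        have hce : c ∈ A.erase b := Finset.mem_erase.2 ⟨hcb, hcA⟩
        refine ⟨A, hA, rfl, ?_⟩
        have e1 := Finset.add_sum_erase A p hbA
        have e2 := Finset.add_sum_erase (A.erase b) p hce
        have e1' := Finset.add_sum_erase A q hbA
        have e2' := Finset.add_sum_erase (A.erase b) q hce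
        have e3 := rest ((A.erase b).erase c) (((Finset.erase_subset _ _).trans (Finset.erase_subset _ _)).trans hA) (by simp [haA]) (by simp)
        linarith
    · exact ⟨A, hA, rfl, rest A hA haA hbA⟩

def PP (W : ℕ → ℝ) (t e : ℝ) (j : ℕ) : ℝ := W j * ((1-t)*j + ((j:ℝ)-(1+e))^2)
def QQ (W : ℕ → ℝ) (t e : ℝ) (j : ℕ) : ℝ := W j * (1+e-j*t + ((j:ℝ)-(1+e))^2)

lemma nonneg_fac (t e : ℝ) (n : ℕ)
    (hs : 1+e = ((n:ℝ)+1)*t) (he : 0 ≤ e) (het : e ≤ t)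
    (j : ℕ) (hj : j ≤ n+1) : 0 ≤ 1+e-j*t := by
  have : (j:ℝ) ≤ n+1 := by exact_mod_cast hj
  rw [hs, ← sub_mul]
  exact mul_nonneg (by linarith) (by linarith)

lemma PP_mono (W : ℕ → ℝ) (t e : ℝ) (n : ℕ)
    (hs : 1+e = ((n:ℝ)+1)*t) (he : 0 ≤ e) (het : e ≤ t) (ht : t ≤ 1/2) (hW : ∀ j, 0 ≤ W j) (hrec : ∀ j : ℕ, j ≤ n+1 → ((j:ℝ)+1)*(1-t)*W (j+1) = W j * (1+e-j*t))
    (j : ℕ) (h2 : 2 ≤ j) (hj : j ≤ n+1) : PP W t e (j+1) ≤ PP W t e j := by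
  have hx : 0 < ((j:ℝ)+1)*(1-t) := mul_pos (by positivity) (by linarith)
  refine le_of_mul_le_mul_left ?_ hx
  have h := ineq_p_mono t e j he het ht (by exact_mod_cast h2) (nonneg_fac t e n hs he het j hj)
  have h := mul_le_mul_of_nonneg_left h (hW j)
  unfold PP
  push_cast
  rw [← mul_assoc, hrec j hj]
  linarith

lemma QQ_mono (W : ℕ → ℝ) (t e : ℝ) (n : ℕ)
    (hn : 2 ≤ n) (hs : 1+e = ((n:ℝ)+1)*t) (he : 0 ≤ e) (het : e ≤ t) (ht : t ≤ 1/2) (hW : ∀ j, 0 ≤ W j) (hrec : ∀ j : ℕ, j ≤ n+1 → ((j:ℝ)+1)*(1-t)*W (j+1) = W j * (1+e-j*t))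
    (j : ℕ) (h2 : 2 ≤ j) (hj : j ≤ n+1) : QQ W t e (j+1) ≤ QQ W t e j := by
  have hx : 0 < ((j:ℝ)+1)*(1-t) := mul_pos (by positivity) (by linarith)
  refine le_of_mul_le_mul_left ?_ hx
  have h : (1+e-j*t)*(1+e-(j+1)*t+((j+1)-(1+e))^2) ≤ (j+1)*(1-t)*(1+e-j*t+(j-(1+e))^2) := by
    rcases h2.eq_or_lt with rfl | h3
    · have := ineq_q_mono2 t e he het ht (by
        rcases hn.eq_or_lt with rfl | h3
        · left; rw [hs]; norm_num
        · right
          have : (3:ℝ) ≤ n := by exact_mod_cast h3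
          rw [hs]; exact mul_le_mul_of_nonneg_right (by linarith) (by linarith))
      norm_num at this ⊢
      linarith
    · exact ineq_q_mono t e j he het ht (by exact_mod_cast h3) (nonneg_fac t e n hs he het j hj)
  have h := mul_le_mul_of_nonneg_left h (hW j)
  unfold QQ
  push_cast
  rw [← mul_assoc, hrec j hj]
  linarith

lemma PP_le (W : ℕ → ℝ) (t e : ℝ) (n : ℕ)
    (hs : 1+e = ((n:ℝ)+1)*t) (he : 0 ≤ e) (het : e ≤ t) (ht : t ≤ 1/2) (hW : ∀ j, 0 ≤ W j) (hrec : ∀ j : ℕ, j ≤ n+1 → ((j:ℝ)+1)*(1-t)*W (j+1) = W j * (1+e-j*t))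
    (j : ℕ) (h2 : 2 ≤ j) (hj : j ≤ n+1) : PP W t e j ≤ PP W t e 2 := by
  induction j, h2 using Nat.le_induction with
  | base => exact le_rfl
  | succ j h2 ih => exact (PP_mono W t e n hs he het ht hW hrec j h2 (by omega)).trans (ih (by omega))

lemma QQ_le2 (W : ℕ → ℝ) (t e : ℝ) (n : ℕ)
    (hn : 2 ≤ n) (hs : 1+e = ((n:ℝ)+1)*t) (he : 0 ≤ e) (het : e ≤ t) (ht : t ≤ 1/2) (hW : ∀ j, 0 ≤ W j) (hrec : ∀ j : ℕ, j ≤ n+1 → ((j:ℝ)+1)*(1-t)*W (j+1) = W j * (1+e-j*t))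
    (j : ℕ) (h2 : 2 ≤ j) (hj : j ≤ n+1) : QQ W t e j ≤ QQ W t e 2 := by
  induction j, h2 using Nat.le_induction with
  | base => exact le_rfl
  | succ j h2 ih =>
    exact (QQ_mono W t e n hn hs he het ht hW hrec j h2 (by omega)).trans (ih (by omega))

lemma QQ_le3 (W : ℕ → ℝ) (t e : ℝ) (n : ℕ)
    (hn : 2 ≤ n) (hs : 1+e = ((n:ℝ)+1)*t) (he : 0 ≤ e) (het : e ≤ t) (ht : t ≤ 1/2) (hW : ∀ j, 0 ≤ W j) (hrec : ∀ j : ℕ, j ≤ n+1 → ((j:ℝ)+1)*(1-t)*W (j+1) = W j * (1+e-j*t))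
    (j : ℕ) (h2 : 3 ≤ j) (hj : j ≤ n+1) : QQ W t e j ≤ QQ W t e 3 := by
  induction j, h2 using Nat.le_induction with
  | base => exact le_rfl
  | succ j h2 ih =>
    exact (QQ_mono W t e n hn hs he het ht hW hrec j (by omega) (by omega)).trans (ih (by omega))

lemma small (W : ℕ → ℝ) (t e : ℝ) (n : ℕ)
    (hn : 2 ≤ n) (hs : 1+e = ((n:ℝ)+1)*t) (he : 0 ≤ e) (het : e ≤ t) (ht : t ≤ 1/2) (hW : ∀ j, 0 ≤ W j) (hrec : ∀ j : ℕ, j ≤ n+1 → ((j:ℝ)+1)*(1-t)*W (j+1) = W j * (1+e-j*t))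
    : QQ W t e 2 ≤ PP W t e 0 ∧ QQ W t e 3 ≤ PP W t e 1 ∧
    QQ W t e 1 + QQ W t e 3 ≤ PP W t e 1 + PP W t e 3 ∧
    PP W t e 1 ≤ QQ W t e 0 ∧ PP W t e 2 ≤ QQ W t e 0 := by
  have hx : 0 < 1 - t := by linarith
  have hk : 3*t = 1+e ∨ 4*t = 1+e ∨ t ≤ 1/4 := by
    rcases hn.eq_or_lt with rfl | h3
    · left; rw [hs]; norm_num
    · right
      rcases (show 3 ≤ n from h3).eq_or_lt with rfl | h4
      · left; rw [hs]; norm_num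
      · right
        have : (4:ℝ) ≤ n := by exact_mod_cast h4
        nlinarith
  have hk' : 3*t = 1+e ∨ t ≤ 1/3 := by
    rcases hk with h | h | h
    · left; exact h
    · right; linarith
    · right; linarith
  obtain ⟨U, hU⟩ : ∃ U, U = W 0 * (1+e) / (6*(1-t)^3) := ⟨_, rfl⟩
  have hU0 : 0 ≤ U := by
    rw [hU]; have := hW 0; positivity
  have w0 : W 0 * (1+e) = 6*(1-t)^3*U := by rw [hU]; field_simp
  have r0 := hrec 0 (by omega)
  have r1 := hrec 1 (by omega)
  have r2 := hrec 2 (by omega)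
  norm_num at r0 r1 r2
  have w1 : W 1 = 6*(1-t)^2*U := by
    apply mul_left_cancel₀ hx.ne'
    linarith
  have w2 : W 2 = 3*(1-t)*(1+e-t)*U := by
    apply mul_left_cancel₀ (show 2*(1-t) ≠ 0 by positivity)
    rw [w1] at r1; linear_combination r1
  have w3 : W 3 = (1+e-t)*(1+e-2*t)*U := by
    apply mul_left_cancel₀ (show 3*(1-t) ≠ 0 by positivity)
    rw [w2] at r2; linear_combination r2
  have P0 : PP W t e 0 = 6*(1-t)^3*(1+e)*U := by
    unfold PP; push_cast; linear_combination (1+e)*w0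
  have Q0 : QQ W t e 0 = 6*(1-t)^3*(2+e)*U := by
    unfold QQ; push_cast; linear_combination (2+e)*w0
  rw [P0, Q0]
  unfold PP QQ
  rw [w1, w2, w3]
  push_cast
  have i1 := mul_le_mul_of_nonneg_right (ineq_p0q2 t e he het ht) (mul_nonneg hx.le hU0)
  have i2 := mul_le_mul_of_nonneg_right (ineq_p1q3 t e he het ht hk) hU0
  have i3 := mul_le_mul_of_nonneg_right (ineq_d3 t e he het ht hk') hU0
  have i4 := mul_le_mul_of_nonneg_right (ineq_q0p2 t e he het ht hk') (mul_nonneg hx.le hU0)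
  have i5 : (1-t+(1-(1+e))^2) ≤ (1-t)*(2+e) := by nlinarith
  have i5 := mul_le_mul_of_nonneg_right i5 (mul_nonneg (sq_nonneg (1-t)) hU0)
  refine ⟨?_, ?_, ?_, ?_, ?_⟩ <;> linarith

lemma total (W : ℕ → ℝ) (t e : ℝ) (n : ℕ)
    (hs : 1+e = ((n:ℝ)+1)*t) (hrec : ∀ j : ℕ, j ≤ n+1 → ((j:ℝ)+1)*(1-t)*W (j+1) = W j * (1+e-j*t))
    : ∑ j ∈ Finset.range (n+2), QQ W t e j = ∑ j ∈ Finset.range (n+2), PP W t e j := by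
  have h : ∑ j ∈ Finset.range (n+2), (PP W t e j - QQ W t e j) = 
     ∑ j ∈ Finset.range (n+2), ((fun j : ℕ => (j:ℝ)*(1-t)*W j) j - (fun j : ℕ => (j:ℝ)*(1-t)*W j) (j+1)) := by
    refine Finset.sum_congr rfl fun j hj => ?_
    have := hrec j (by have := Finset.mem_range.1 hj; omega)
    unfold PP QQ; push_cast
    linear_combination this
  rw [Finset.sum_range_sub', Finset.sum_sub_distrib] at h
  have := hrec (n+1) le_rfl
  push_cast at this h
  rw [show 1+e-((n:ℝ)+1)*t = 0 by rw [hs]; ring] at this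
  linarith

lemma QQ_le_PP (W : ℕ → ℝ) (t e : ℝ)
    (hW : ∀ j, 0 ≤ W j)
    (j : ℕ) (hj : 2 ≤ j) (het : e ≤ t) (ht : t ≤ 1/2) : QQ W t e j ≤ PP W t e j := by
  have : (2:ℝ) ≤ j := by exact_mod_cast hj
  unfold QQ PP
  apply mul_le_mul_of_nonneg_left _ (hW j)
  linarith

/-- p(n,λ) is majorised by q(n,λ): for every k, the sum of the k+1 smallest entries of p
is at least the sum of the k+1 smallest entries of q.  Equivalently, every sum of p over a
subset of cardinality k+1 dominates some sum of q over a subset of cardinality k+1. -/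
theorem pdist_majorised_by_qdist (n : ℕ) (hn : 2 ≤ n) (t : ℝ)
    (h1 : 1 / ((n : ℝ) + 1) ≤ t) (h2 : t ≤ 1 / (n : ℝ)) :
    ∀ k : ℕ, k ≤ n + 1 → ∀ A : Finset ℕ, A ⊆ Finset.range (n + 2) → A.card = k + 1 →
      ∃ B : Finset ℕ, B ⊆ Finset.range (n + 2) ∧ B.card = k + 1 ∧
        ∑ ℓ ∈ B, qdist n ℓ t ≤ ∑ ℓ ∈ A, pdist n ℓ t := by
  intro k _ A hA hk
  have hn' : (2:ℝ) ≤ n := by exact_mod_cast hn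
  have g1 : 1 ≤ ((n:ℝ)+1)*t := by rwa [div_le_iff₀' (by linarith)] at h1
  have g2 : (n:ℝ)*t ≤ 1 := by rwa [le_div_iff₀' (by linarith)] at h2
  have ht0 : 0 < t := by by_contra hc; nlinarith
  have ht : t ≤ 1/2 := by nlinarith
  have hx : 0 < 1 - t := by linarith
  obtain ⟨e, hs⟩ : ∃ e, 1+e = ((n:ℝ)+1)*t := ⟨((n:ℝ)+1)*t - 1, by ring⟩
  have he : 0 ≤ e := by linarith
  have het : e ≤ t := by linarith
  obtain ⟨W, hWd⟩ : ∃ W : ℕ → ℝ, ∀ j, W j = ((n+1).choose j : ℝ) * (1-t)^(n+1-j) * t^j := ⟨_, fun _ => rfl⟩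
  have hW : ∀ j, 0 ≤ W j := by intro j; rw [hWd]; positivity
  have hrec : ∀ j : ℕ, j ≤ n+1 → ((j:ℝ)+1)*(1-t)*W (j+1) = W j * (1+e-j*t) := by
    intro j hj
    have hc : ((n+1).choose (j+1) : ℝ) * ((j:ℝ)+1) = (n+1).choose j * ((n:ℝ)+1-j) := by
      have := Nat.choose_succ_right_eq (n+1) j
      have := congrArg (Nat.cast : ℕ → ℝ) this
      push_cast [Nat.cast_sub hj] at this
      exact this
    rw [hWd, hWd, hs]
    rcases hj.eq_or_lt with rfl | hlt
    · simp
    · have e1 : n+1-j = (n+1-(j+1))+1 := by omega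
      rw [e1, pow_succ, pow_succ]
      linear_combination (1-t)^(n+1-(j+1)) * (1-t) * t^j * t * hc
  obtain ⟨K, hK⟩ : ∃ K, K = 2*((n:ℝ)+1)*(1-t)*t := ⟨_, rfl⟩
  have hK0 : 0 < K := by rw [hK]; positivity
  have hp : ∀ j ≤ n+1, pdist n (n+1-j) t = PP W t e j / K := by
    intro j hj
    rw [eq_div_iff hK0.ne', hK]
    unfold pdist PP
    rw [hWd, hs]
    rcases Nat.eq_zero_or_pos j with rfl | hpos
    · simp [pow_succ]; ring
    · have hle : n+1-j ≤ n := by omega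
      have e1 : n - (n+1-j) = j-1 := by omega
      rw [if_pos hle, e1, Nat.choose_symm hj, Nat.cast_sub hj]
      obtain ⟨i, rfl⟩ : ∃ i, j = i+1 := ⟨j-1, by omega⟩
      rw [Nat.add_sub_cancel, pow_succ]
      push_cast
      field_simp
      ring
  have hq : ∀ j ≤ n+1, qdist n (n+1-j) t = QQ W t e j / K := by
    intro j hj
    rw [eq_div_iff hK0.ne', hK]
    unfold qdist QQ
    rw [hWd, hs]
    rcases Nat.eq_zero_or_pos j with rfl | hpos
    · simp [pow_succ]; ring
    · have hle : n+1-j ≤ n := by omega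
      have e1 : n - (n+1-j) = j-1 := by omega
      rw [if_pos hle, e1, Nat.choose_symm hj, Nat.cast_sub hj]
      obtain ⟨i, rfl⟩ : ∃ i, j = i+1 := ⟨j-1, by omega⟩
      rw [Nat.add_sub_cancel, pow_succ]
      push_cast
      field_simp
      ring
  have hp' : ∀ l < n+2, pdist n l t = PP W t e (n+1-l) / K := by
    intro l hl
    rw [← hp _ (by omega)]; congr 1; omega
  have hq' : ∀ l < n+2, qdist n l t = QQ W t e (n+1-l) / K := by
    intro l hl
    rw [← hq _ (by omega)]; congr 1; omega
  obtain ⟨s1, s2, s3, s4, s5⟩ := small W t e n hn hs he het ht hW hrec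
  have j0 : n+1-(n+1) = 0 := by omega
  have j1 : n+1-n = 1 := by omega
  have j3 : n+1-(n-2) = 3 := by omega
  rw [← hk]
  apply comb (Finset.range (n+2)) (fun l => pdist n l t) (fun l => qdist n l t) (n+1) n (n-1) (n-2)
    (by simp) (by simp) (by simp; omega) (by omega) (by omega) (by omega) (by omega)
  · rw [← Finset.sum_range_reflect (fun l => qdist n l t), ← Finset.sum_range_reflect (fun l => pdist n l t)]
    have a1 : ∑ j ∈ Finset.range (n+2), qdist n (n+2-1-j) t = ∑ j ∈ Finset.range (n+2), QQ W t e j / K :=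
      Finset.sum_congr rfl fun j hj => hq j (by have := Finset.mem_range.1 hj; omega)
    have a2 : ∑ j ∈ Finset.range (n+2), pdist n (n+2-1-j) t = ∑ j ∈ Finset.range (n+2), PP W t e j / K :=
      Finset.sum_congr rfl fun j hj => hp j (by have := Finset.mem_range.1 hj; omega)
    rw [a1, a2, ← Finset.sum_div, ← Finset.sum_div, total W t e n hs hrec]
  · intro l hl ha hb
    have hl := Finset.mem_range.1 hl
    simp only [hp' l hl, hq' l hl]
    exact div_le_div_of_nonneg_right (QQ_le_PP W t e hW _ (by omega) het ht) hK0.le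
  · intro l hl ha hb
    have hl := Finset.mem_range.1 hl
    simp only [hp' (n+1) (by omega), hq' l hl, j0]
    exact div_le_div_of_nonneg_right ((QQ_le2 W t e n hn hs he het ht hW hrec _ (by omega) (by omega)).trans s1) hK0.le
  · intro l hl ha hb hc
    have hl := Finset.mem_range.1 hl
    simp only [hp' n (by omega), hq' l hl, j1]
    exact div_le_div_of_nonneg_right ((QQ_le3 W t e n hn hs he het ht hW hrec _ (by omega) (by omega)).trans s2) hK0.le
  · simp only [hp' n (by omega), hq' n (by omega), hp' (n-2) (by omega), hq' (n-2) (by omega), j1, j3]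
    rw [← add_div, ← add_div]
    exact div_le_div_of_nonneg_right s3 hK0.le
  · intro l hl ha
    have hl := Finset.mem_range.1 hl
    simp only [hp' l hl, hq' (n+1) (by omega), j0]
    refine div_le_div_of_nonneg_right ?_ hK0.le
    by_cases hb : l = n
    · rw [hb, j1]; exact s4
    · exact (PP_le W t e n hs he het ht hW hrec _ (by omega) (by omega)).trans s5
  · exact hA
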